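/- (a) For every φ ∈ Σ_1, Ext^1(R_φ(1), R_φ(1)') ≅ F_q and the middle term of any non-split short exact sequence 0 → R_φ(1)' → E → R_φ(1) → 0 is isomorphic to M; similarly Ext^1(R_φ(1)', R_φ(1)) ≅ F_q with non-split middle term isomorphic to M'. (b) If φ, π ∈ Σ and φ ≠ π, then Ext^1(R_φ(m), R_π(n)') = 0 and Ext^1(R_π(n)', R_φ(m)) = 0 for all m, n ≥ 1. -/

import Mathlib

open scoped Classical
set_option maxHeartbeats 1000000

noncomputable section

/-- A finite-dimensional representation of the Rudakov quiver `Q_Rud` over a field `k`: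
two finite-dimensional vector spaces `V₁`, `V₂`, maps `e f : V₁ → V₂` and
`e' f' : V₂ → V₁` satisfying `ee' = e'e = ff' = f'f = 0`, `ef' = -fe'`, `e'f = -f'e`. -/
structure RudRep (k : Type) [Field k] : Type 1 where
  V₁ : Type
  V₂ : Type
  [acg₁ : AddCommGroup V₁]
  [acg₂ : AddCommGroup V₂]
  [mod₁ : Module k V₁]
  [mod₂ : Module k V₂]
  [fd₁ : FiniteDimensional k V₁]
  [fd₂ : FiniteDimensional k V₂]
  e : V₁ →ₗ[k] V₂
  f : V₁ →ₗ[k] V₂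
  e' : V₂ →ₗ[k] V₁
  f' : V₂ →ₗ[k] V₁
  rel_ee' : e ∘ₗ e' = 0
  rel_e'e : e' ∘ₗ e = 0
  rel_ff' : f ∘ₗ f' = 0
  rel_f'f : f' ∘ₗ f = 0
  rel_ef' : e ∘ₗ f' = -(f ∘ₗ e')
  rel_e'f : e' ∘ₗ f = -(f' ∘ₗ e)

attribute [instance] RudRep.acg₁ RudRep.acg₂ RudRep.mod₁ RudRep.mod₂ RudRep.fd₁ RudRep.fd₂

variable {k : Type} [Field k]

namespace RudRep

lemma ee'_apply (X : RudRep k) (y : X.V₂) : X.e (X.e' y) = 0 := by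
  simpa using DFunLike.congr_fun X.rel_ee' y
lemma e'e_apply (X : RudRep k) (x : X.V₁) : X.e' (X.e x) = 0 := by
  simpa using DFunLike.congr_fun X.rel_e'e x
lemma ff'_apply (X : RudRep k) (y : X.V₂) : X.f (X.f' y) = 0 := by
  simpa using DFunLike.congr_fun X.rel_ff' y
lemma f'f_apply (X : RudRep k) (x : X.V₁) : X.f' (X.f x) = 0 := by
  simpa using DFunLike.congr_fun X.rel_f'f x
lemma ef'_apply (X : RudRep k) (y : X.V₂) : X.e (X.f' y) = -(X.f (X.e' y)) := by
  simpa using DFunLike.congr_fun X.rel_ef' y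
lemma e'f_apply (X : RudRep k) (x : X.V₁) : X.e' (X.f x) = -(X.f' (X.e x)) := by
  simpa using DFunLike.congr_fun X.rel_e'f x

/-- The involution `σ` swapping the two vertices and interchanging `e ↔ e'`, `f ↔ f'`. -/
def sigma (X : RudRep k) : RudRep k where
  V₁ := X.V₂
  V₂ := X.V₁
  e := X.e'
  f := X.f'
  e' := X.e
  f' := X.f
  rel_ee' := X.rel_e'e
  rel_e'e := X.rel_ee'
  rel_ff' := X.rel_f'f
  rel_f'f := X.rel_ff'
  rel_ef' := X.rel_e'f
  rel_e'f := X.rel_ef'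

/-- A representation is zero iff both underlying spaces are trivial. -/
def IsZero (X : RudRep k) : Prop := Subsingleton X.V₁ ∧ Subsingleton X.V₂

/-- Direct sum of two representations of the Rudakov quiver. -/
def dsum (X Y : RudRep k) : RudRep k where
  V₁ := X.V₁ × Y.V₁
  V₂ := X.V₂ × Y.V₂
  e := X.e.prodMap Y.e
  f := X.f.prodMap Y.f
  e' := X.e'.prodMap Y.e'
  f' := X.f'.prodMap Y.f'
  rel_ee' := by
    apply LinearMap.ext; rintro ⟨a, b⟩
    simp [Prod.ext_iff, ee'_apply]
  rel_e'e := by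
    apply LinearMap.ext; rintro ⟨a, b⟩
    simp [Prod.ext_iff, e'e_apply]
  rel_ff' := by
    apply LinearMap.ext; rintro ⟨a, b⟩
    simp [Prod.ext_iff, ff'_apply]
  rel_f'f := by
    apply LinearMap.ext; rintro ⟨a, b⟩
    simp [Prod.ext_iff, f'f_apply]
  rel_ef' := by
    apply LinearMap.ext; rintro ⟨a, b⟩
    simp [Prod.ext_iff, ef'_apply]
  rel_e'f := by
    apply LinearMap.ext; rintro ⟨a, b⟩
    simp [Prod.ext_iff, e'f_apply]

/-- The zero representation. -/
def zeroRep (k : Type) [Field k] : RudRep k where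
  V₁ := Fin 0 → k
  V₂ := Fin 0 → k
  e := 0
  f := 0
  e' := 0
  f' := 0
  rel_ee' := by simp
  rel_e'e := by simp
  rel_ff' := by simp
  rel_f'f := by simp
  rel_ef' := by simp
  rel_e'f := by simp

/-- `n`-fold direct sum `X^{⊕ n}`. -/
def npow (X : RudRep k) : ℕ → RudRep k
  | 0 => zeroRep k
  | n + 1 => (npow X n).dsum X

end RudRep

/-- Morphisms of representations of `Q_Rud`, as a submodule of the product of Hom spaces:
pairs of linear maps commuting with `e, f, e', f'`. -/
def RudHomS (X Y : RudRep k) :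
    Submodule k ((X.V₁ →ₗ[k] Y.V₁) × (X.V₂ →ₗ[k] Y.V₂)) where
  carrier := {p | Y.e ∘ₗ p.1 = p.2 ∘ₗ X.e ∧ Y.f ∘ₗ p.1 = p.2 ∘ₗ X.f ∧
      Y.e' ∘ₗ p.2 = p.1 ∘ₗ X.e' ∧ Y.f' ∘ₗ p.2 = p.1 ∘ₗ X.f'}
  add_mem' := by
    intro a b ha hb
    obtain ⟨ha1, ha2, ha3, ha4⟩ := ha
    obtain ⟨hb1, hb2, hb3, hb4⟩ := hb
    refine ⟨?_, ?_, ?_, ?_⟩ <;>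
      simp only [Prod.fst_add, Prod.snd_add, LinearMap.add_comp, LinearMap.comp_add,
        ha1, ha2, ha3, ha4, hb1, hb2, hb3, hb4]
  zero_mem' := by
    refine ⟨?_, ?_, ?_, ?_⟩ <;> simp
  smul_mem' := by
    intro c a ha
    obtain ⟨h1, h2, h3, h4⟩ := ha
    refine ⟨?_, ?_, ?_, ?_⟩ <;>
      simp only [Prod.smul_fst, Prod.smul_snd, LinearMap.smul_comp, LinearMap.comp_smul,
        h1, h2, h3, h4]

/-- The space of morphisms of representations `X → Y`. -/
abbrev RudHom (X Y : RudRep k) : Type := ↥(RudHomS X Y)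

private lemma square_comp
    {A₁ A₂ B₁ B₂ C₁ C₂ : Type}
    [AddCommGroup A₁] [AddCommGroup A₂] [AddCommGroup B₁] [AddCommGroup B₂]
    [AddCommGroup C₁] [AddCommGroup C₂]
    [Module k A₁] [Module k A₂] [Module k B₁] [Module k B₂] [Module k C₁] [Module k C₂]
    (u : A₁ →ₗ[k] A₂) (v : B₁ →ₗ[k] B₂) (w : C₁ →ₗ[k] C₂)
    (h₁ : A₁ →ₗ[k] B₁) (h₂ : A₂ →ₗ[k] B₂) (g₁ : B₁ →ₗ[k] C₁) (g₂ : B₂ →ₗ[k] C₂)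
    (hh : v ∘ₗ h₁ = h₂ ∘ₗ u) (hg : w ∘ₗ g₁ = g₂ ∘ₗ v) :
    w ∘ₗ (g₁ ∘ₗ h₁) = (g₂ ∘ₗ h₂) ∘ₗ u := by
  apply LinearMap.ext
  intro x
  have e1 := DFunLike.congr_fun hh x
  have e2 := DFunLike.congr_fun hg (h₁ x)
  simp only [LinearMap.comp_apply] at e1 e2 ⊢
  rw [e2, e1]

/-- Composition of morphisms of representations. -/
def RudHom.comp {X Y Z : RudRep k} (g : RudHom Y Z) (h : RudHom X Y) : RudHom X Z := by
  refine ⟨(g.1.1 ∘ₗ h.1.1, g.1.2 ∘ₗ h.1.2), ?_⟩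
  obtain ⟨hg1, hg2, hg3, hg4⟩ := g.2
  obtain ⟨hh1, hh2, hh3, hh4⟩ := h.2
  exact ⟨square_comp X.e Y.e Z.e h.1.1 h.1.2 g.1.1 g.1.2 hh1 hg1,
    square_comp X.f Y.f Z.f h.1.1 h.1.2 g.1.1 g.1.2 hh2 hg2,
    square_comp X.e' Y.e' Z.e' h.1.2 h.1.1 g.1.2 g.1.1 hh3 hg3,
    square_comp X.f' Y.f' Z.f' h.1.2 h.1.1 g.1.2 g.1.1 hh4 hg4⟩

/-- The identity morphism. -/
def RudHom.idHom (X : RudRep k) : RudHom X X :=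
  ⟨(LinearMap.id, LinearMap.id), by refine ⟨?_, ?_, ?_, ?_⟩ <;> simp⟩

/-- Two representations are isomorphic iff there is a morphism between them whose
components are bijective. -/
def RudIso (X Y : RudRep k) : Prop :=
  ∃ g : RudHom X Y, Function.Bijective g.1.1 ∧ Function.Bijective g.1.2

/-- A representation is indecomposable if it is nonzero and any decomposition as a direct
sum has a trivial summand. -/
def RudRep.Indec (X : RudRep k) : Prop :=
  ¬ X.IsZero ∧ ∀ Y Z : RudRep k, RudIso X (Y.dsum Z) → Y.IsZero ∨ Z.IsZero

namespace RudRep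

/-- Build a representation of `Q_Rud` from a representation of the Kronecker quiver,
extending by zero (`e' = f' = 0`). -/
def ofKron {V W : Type} [AddCommGroup V] [AddCommGroup W] [Module k V] [Module k W]
    [FiniteDimensional k V] [FiniteDimensional k W] (e f : V →ₗ[k] W) : RudRep k where
  V₁ := V
  V₂ := W
  e := e
  f := f
  e' := 0
  f' := 0
  rel_ee' := by simp
  rel_e'e := by simp
  rel_ff' := by simp
  rel_f'f := by simp
  rel_ef' := by simp
  rel_e'f := by simp

/-- Build a representation of `Q_Rud` from four matrices satisfying the relations. -/
def ofMatrices {m n : ℕ} (E F : Matrix (Fin n) (Fin m) k) (E' F' : Matrix (Fin m) (Fin n) k)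
    (h1 : E * E' = 0) (h2 : E' * E = 0) (h3 : F * F' = 0) (h4 : F' * F = 0)
    (h5 : E * F' = -(F * E')) (h6 : E' * F = -(F' * E)) : RudRep k where
  V₁ := Fin m → k
  V₂ := Fin n → k
  e := Matrix.toLin' E
  f := Matrix.toLin' F
  e' := Matrix.toLin' E'
  f' := Matrix.toLin' F'
  rel_ee' := by rw [← Matrix.toLin'_mul, h1]; simp
  rel_e'e := by rw [← Matrix.toLin'_mul, h2]; simp
  rel_ff' := by rw [← Matrix.toLin'_mul, h3]; simp
  rel_f'f := by rw [← Matrix.toLin'_mul, h4]; simp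
  rel_ef' := by rw [← Matrix.toLin'_mul, ← Matrix.toLin'_mul, h5]; simp
  rel_e'f := by rw [← Matrix.toLin'_mul, ← Matrix.toLin'_mul, h6]; simp

end RudRep

/-- The projective-injective representation `M`, with `e x₁ = y₁`, `f x₁ = y₂`,
`e' y₂ = x₂`, `f' y₁ = -x₂` on bases `x₁, x₂` of `M₁` and `y₁, y₂` of `M₂`. -/
def repM (k : Type) [Field k] : RudRep k :=
  RudRep.ofMatrices (k := k)
    !![(1 : k), 0; 0, 0] !![(0 : k), 0; 1, 0] !![(0 : k), 0; 0, 1] !![(0 : k), 0; -1, 0]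
    (by ext i j; fin_cases i <;> fin_cases j <;>
      simp [Matrix.mul_apply, Fin.sum_univ_two])
    (by ext i j; fin_cases i <;> fin_cases j <;>
      simp [Matrix.mul_apply, Fin.sum_univ_two])
    (by ext i j; fin_cases i <;> fin_cases j <;>
      simp [Matrix.mul_apply, Fin.sum_univ_two])
    (by ext i j; fin_cases i <;> fin_cases j <;>
      simp [Matrix.mul_apply, Fin.sum_univ_two])
    (by ext i j; fin_cases i <;> fin_cases j <;>
      simp [Matrix.mul_apply, Fin.sum_univ_two])
    (by ext i j; fin_cases i <;> fin_cases j <;>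
      simp [Matrix.mul_apply, Fin.sum_univ_two])

/-- The projective-injective representation `M' = σ(M)`. -/
def repM' (k : Type) [Field k] : RudRep k := (repM k).sigma

/-- `0 → B → E → A → 0` is a short exact sequence. -/
structure IsSES {B E A : RudRep k} (ι : RudHom B E) (π : RudHom E A) : Prop where
  inj₁ : Function.Injective ι.1.1
  inj₂ : Function.Injective ι.1.2
  surj₁ : Function.Surjective π.1.1
  surj₂ : Function.Surjective π.1.2
  ex₁ : LinearMap.range ι.1.1 = LinearMap.ker π.1.1
  ex₂ : LinearMap.range ι.1.2 = LinearMap.ker π.1.2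

/-- A surjection splits iff it admits a section. -/
def Splits {E A : RudRep k} (π : RudHom E A) : Prop :=
  ∃ s : RudHom A E, RudHom.comp π s = RudHom.idHom A

/-- `Ext¹(A, B) = 0`: every short exact sequence `0 → B → E → A → 0` splits. -/
def Ext1IsZero (A B : RudRep k) : Prop :=
  ∀ (E : RudRep k) (ι : RudHom B E) (π : RudHom E A), IsSES ι π → Splits π

/-- An extension of `A` by `B`, i.e. a short exact sequence `0 → B → E → A → 0`. -/
structure RudExtn (A B : RudRep k) : Type 1 where
  E : RudRep k
  ι : RudHom B E
  π : RudHom E A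
  ses : IsSES ι π

/-- Equivalence of extensions (Yoneda-Ext equivalence: an isomorphism of middle terms
commuting with the inclusions and projections). -/
def RudExtnEquiv {A B : RudRep k} (x y : RudExtn A B) : Prop :=
  ∃ φ : RudHom x.E y.E, Function.Bijective φ.1.1 ∧ Function.Bijective φ.1.2 ∧
    RudHom.comp φ x.ι = y.ι ∧ RudHom.comp y.π φ = x.π

/-- The number of equivalence classes of extensions of `A` by `B`
(equal to the cardinality of `Ext¹(A,B)` for a finitary category). -/
def ext1Card (A B : RudRep k) : ℕ :=
  Nat.card (Quot (RudExtnEquiv (A := A) (B := B)))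

/-- The matrix of the inclusion of `k^n` into the first `n` coordinates of `k^{n+1}`. -/
def inclFirstMat (k : Type) [Field k] (n : ℕ) : Matrix (Fin (n + 1)) (Fin n) k :=
  Matrix.of fun j i => if (j : ℕ) = (i : ℕ) then 1 else 0

/-- The matrix of the inclusion of `k^n` into the last `n` coordinates of `k^{n+1}`. -/
def inclLastMat (k : Type) [Field k] (n : ℕ) : Matrix (Fin (n + 1)) (Fin n) k :=
  Matrix.of fun j i => if (j : ℕ) = (i : ℕ) + 1 then 1 else 0

/-- The pre-projective representation `P_n` of dimension `(n, n+1)`, with `e` the inclusion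
into the first `n` coordinates, `f` the inclusion into the last `n`, and `e' = f' = 0`. -/
def Prep (k : Type) [Field k] (n : ℕ) : RudRep k :=
  RudRep.ofKron (Matrix.toLin' (inclFirstMat k n)) (Matrix.toLin' (inclLastMat k n))

/-- The pre-injective representation `I_n` of dimension `(n+1, n)`, with `e` the projection
onto the first `n` coordinates, `f` the projection onto the last `n`, and `e' = f' = 0`. -/
def Irep (k : Type) [Field k] (n : ℕ) : RudRep k :=
  RudRep.ofKron (Matrix.toLin' (inclFirstMat k n).transpose)
    (Matrix.toLin' (inclLastMat k n).transpose)

/-- `φ ∈ Σ`: `φ` is a monic irreducible polynomial, or the zero polynomial. -/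
def InSigma (φ : Polynomial k) : Prop := φ = 0 ∨ (φ.Monic ∧ Irreducible φ)

/-- `φ ∈ Σ₁`: `φ` is a monic polynomial of degree 1, or the zero polynomial. -/
def InSigma1 (φ : Polynomial k) : Prop := φ = 0 ∨ (φ.Monic ∧ φ.natDegree = 1)

/-- The degree of an element of `Σ`, with the convention `deg 0 = 1`. -/
def sigDeg (φ : Polynomial k) : ℕ := if φ = 0 then 1 else φ.natDegree

/-- The `d × d` companion matrix of a monic polynomial of degree `d`. -/
def companionMat (d : ℕ) (φ : Polynomial k) : Matrix (Fin d) (Fin d) k :=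
  Matrix.of fun i j =>
    if (j : ℕ) + 1 = d then -φ.coeff (i : ℕ) else if (i : ℕ) = (j : ℕ) + 1 then 1 else 0

/-- The `dn × dn` block matrix with `n` diagonal blocks equal to `C` and `d × d`
identity blocks on the superdiagonal. -/
def Mblock {d : ℕ} (C : Matrix (Fin d) (Fin d) k) (n : ℕ) :
    Matrix (Fin n × Fin d) (Fin n × Fin d) k :=
  Matrix.of fun p q =>
    if p.1 = q.1 then C p.2 q.2
    else if (q.1 : ℕ) = (p.1 : ℕ) + 1 ∧ p.2 = q.2 then 1 else 0

/-- The regular representation `R_φ(n)` for `φ ∈ Σ`: for `φ ≠ 0` this is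
`(e, f) = (Id, M_φ(n))` and `e' = f' = 0`; for `φ = 0` it is `(e, f) = (J_n, Id)`. -/
def Rrep (φ : Polynomial k) (n : ℕ) : RudRep k :=
  if φ = 0 then
    RudRep.ofKron (Matrix.toLin' (Mblock (0 : Matrix (Fin 1) (Fin 1) k) n))
      (Matrix.toLin' (1 : Matrix (Fin n × Fin 1) (Fin n × Fin 1) k))
  else
    RudRep.ofKron
      (Matrix.toLin' (1 : Matrix (Fin n × Fin φ.natDegree) (Fin n × Fin φ.natDegree) k))
      (Matrix.toLin' (Mblock (companionMat φ.natDegree φ) n))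

open Polynomial

section Annihilation

/-- A polynomial in a block upper bidiagonal matrix acts on the last non-vanishing block of a
vector through the diagonal block. -/
lemma aeval_Mblock_apply {d : ℕ} (C : Matrix (Fin d) (Fin d) k) (n j : ℕ) (p : k[X])
    (v : Fin n × Fin d → k) (hv : ∀ i : Fin n, j < i → ∀ a, v (i, a) = 0)
    (i : Fin n) (hi : j ≤ i) :
    (fun a => aeval (Matrix.toLin' (Mblock C n)) p v (i, a)) =
      aeval (Matrix.toLin' C) p (fun a => v (i, a)) := by
  have step : ∀ w : Fin n × Fin d → k, (∀ i : Fin n, j < i → ∀ a, w (i, a) = 0) →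
      ∀ i : Fin n, j ≤ i → (fun a => Matrix.toLin' (Mblock C n) w (i, a)) =
        Matrix.toLin' C (fun a => w (i, a)) := by
    intro w hw i hi
    funext a
    simp only [Matrix.toLin'_apply, Matrix.mulVec, dotProduct, Fintype.sum_prod_type]
    rw [Finset.sum_eq_single i]
    · simp [Mblock]
    · intro l _ hl
      refine Finset.sum_eq_zero fun b _ => ?_
      by_cases h : (l : ℕ) = i + 1
      · rw [hw l (by omega), mul_zero]
      · simp [Mblock, h, Ne.symm hl]
    · simp
  have pow : ∀ t : ℕ, ∀ i : Fin n, j ≤ i →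
      (fun a => (Matrix.toLin' (Mblock C n) ^ t) v (i, a)) =
        (Matrix.toLin' C ^ t) (fun a => v (i, a)) := by
    intro t
    induction t with
    | zero => intro i _; simp
    | succ t ih =>
      intro i hi
      rw [pow_succ', pow_succ', Module.End.mul_apply, Module.End.mul_apply, ← ih i hi]
      refine step _ (fun l hl a => ?_) i hi
      have h := congrFun (ih l hl.le) a
      rw [h, show (fun a => v (l, a)) = 0 from funext (hv l hl), map_zero]
      rfl
  induction p using Polynomial.induction_on' with
  | add p q hp hq =>
    rw [map_add, map_add, LinearMap.add_apply, LinearMap.add_apply, ← hp, ← hq]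
    rfl
  | monomial t c =>
    rw [aeval_monomial, aeval_monomial, Module.End.mul_apply, Module.End.mul_apply, ← pow t i hi]
    rfl

lemma aeval_pow_Mblock {d : ℕ} (C : Matrix (Fin d) (Fin d) k) (n : ℕ) (p : k[X])
    (hp : aeval (Matrix.toLin' C) p = 0) :
    aeval (Matrix.toLin' (Mblock C n)) (p ^ n) = 0 := by
  have key : ∀ t : ℕ, ∀ v : Fin n × Fin d → k, (∀ i : Fin n, t ≤ i → ∀ a, v (i, a) = 0) →
      aeval (Matrix.toLin' (Mblock C n)) (p ^ t) v = 0 := by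
    intro t
    induction t with
    | zero =>
      intro v hv
      rw [show v = 0 from funext fun x => hv x.1 (Nat.zero_le _) x.2, map_zero]
    | succ t ih =>
      intro v hv
      rw [pow_succ, map_mul, Module.End.mul_apply]
      refine ih _ fun i hi a => ?_
      have h := congrFun (aeval_Mblock_apply C n t p v (fun i hi => hv i hi) i hi) a
      rw [h, hp]
      rfl
  exact LinearMap.ext fun v => key n v fun i hi => absurd i.2 (by omega)

lemma aeval_companionMat (φ : k[X]) (hφ : φ.Monic) :
    aeval (Matrix.toLin' (companionMat φ.natDegree φ)) φ = 0 := by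
  set d := φ.natDegree with hd
  set L := Matrix.toLin' (companionMat d φ) with hL
  rcases Nat.eq_zero_or_pos d with h0 | hpos
  · have : IsEmpty (Fin d) := by rw [h0]; infer_instance
    exact LinearMap.ext fun v => Subsingleton.elim _ _
  have hpow : ∀ j (hj : j < d), (L ^ j) (Pi.single ⟨0, hpos⟩ 1) = Pi.single ⟨j, hj⟩ 1 := by
    intro j
    induction j with
    | zero => intro _; simp
    | succ j ih =>
      intro hj
      rw [pow_succ', Module.End.mul_apply, ih (by omega), hL, Matrix.toLin'_apply,
        Matrix.mulVec_single_one]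
      funext a
      simp [companionMat, Pi.single_apply, Fin.ext_iff, show j + 1 ≠ d by omega]
  have htop : (L ^ d) (Pi.single ⟨0, hpos⟩ 1) = fun i : Fin d => -φ.coeff i := by
    obtain ⟨c, hc⟩ : ∃ c, d = c + 1 := ⟨d - 1, by omega⟩
    rw [show L ^ d = L * L ^ c by rw [← pow_succ', ← hc], Module.End.mul_apply,
      hpow c (by omega), hL, Matrix.toLin'_apply, Matrix.mulVec_single_one]
    funext a
    simp [companionMat, ← hc]
  have hzero : aeval L φ (Pi.single ⟨0, hpos⟩ 1) = 0 := by
    rw [aeval_eq_sum_range, ← hd, Finset.sum_range_succ, LinearMap.add_apply,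
      LinearMap.smul_apply, htop, show φ.coeff d = 1 from hφ, one_smul, LinearMap.sum_apply,
      Finset.sum_range]
    funext a
    simp only [LinearMap.smul_apply, hpow _ (Fin.is_lt _)]
    simp [Finset.sum_apply, Pi.single_apply]
  refine LinearMap.pi_ext' fun i => LinearMap.ext_ring ?_
  have : (Pi.single i 1 : Fin d → k) = (L ^ (i : ℕ)) (Pi.single ⟨0, hpos⟩ 1) :=
    (hpow i i.2).symm
  simp only [LinearMap.comp_apply, LinearMap.single_apply, LinearMap.zero_apply]
  rw [this, ← Module.End.mul_apply,
    show aeval L φ * L ^ (i : ℕ) = L ^ (i : ℕ) * aeval L φ by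
      rw [← aeval_X_pow (R := k) L, ← map_mul, mul_comm, map_mul],
    Module.End.mul_apply, hzero, map_zero]

variable {V W : Type} [AddCommGroup V] [AddCommGroup W] [Module k V] [Module k W]

lemma aeval_comp_of_intertwines (N : Module.End k V) (Q : Module.End k W) (γ : V →ₗ[k] W)
    (h : Q ∘ₗ γ = γ ∘ₗ N) (p : k[X]) : aeval Q p ∘ₗ γ = γ ∘ₗ aeval N p := by
  have pow : ∀ t : ℕ, ∀ v, (Q ^ t) (γ v) = γ ((N ^ t) v) := by
    intro t
    induction t with
    | zero => intro v; simp
    | succ t ih =>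
      intro v
      rw [pow_succ, pow_succ, Module.End.mul_apply, Module.End.mul_apply, ← ih,
        show Q (γ v) = γ (N v) from DFunLike.congr_fun h v]
  refine LinearMap.ext fun v => ?_
  simp only [LinearMap.comp_apply]
  induction p using Polynomial.induction_on' with
  | add p q hp hq => simp [hp, hq]
  | monomial t c => simp [aeval_monomial, pow]

lemma intertwiner_eq_zero_of_isCoprime (N : Module.End k V) (Q : Module.End k W)
    {p q : k[X]} (hpq : IsCoprime p q) (hp : aeval N p = 0) (hq : aeval Q q = 0)
    (γ : V →ₗ[k] W) (h : Q ∘ₗ γ = γ ∘ₗ N) : γ = 0 := by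
  obtain ⟨a, b, hab⟩ := hpq
  have h1 := aeval_comp_of_intertwines N Q γ h (a * p)
  have h2 : aeval Q (a * p) = 1 := by
    rw [eq_sub_of_add_eq hab]
    simp [hq]
  rw [h2, map_mul, hp, mul_zero, LinearMap.comp_zero] at h1
  exact h1

lemma eq_zero_of_eq_comp_comp (N : Module.End k V) (P : Module.End k W) (γ : V →ₗ[k] W)
    (h : ∀ v, γ v = P (γ (N v))) (hn : IsNilpotent P ∨ IsNilpotent N) : γ = 0 := by
  have pow : ∀ t : ℕ, ∀ v, γ v = (P ^ t) (γ ((N ^ t) v)) := by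
    intro t
    induction t with
    | zero => intro v; simp
    | succ t ih =>
      intro v
      rw [pow_succ, pow_succ', Module.End.mul_apply, Module.End.mul_apply, ← h, ← ih]
  refine LinearMap.ext fun v => ?_
  rcases hn with ⟨t, ht⟩ | ⟨t, ht⟩ <;> simp [pow t v, ht]

lemma isNilpotent_Mblock_zero (n : ℕ) :
    IsNilpotent (Matrix.toLin' (Mblock (0 : Matrix (Fin 1) (Fin 1) k) n)) := by
  refine ⟨n, ?_⟩
  have := aeval_pow_Mblock (0 : Matrix (Fin 1) (Fin 1) k) n X (by simp)
  simpa using this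

end Annihilation

section Duality

/-- The functorial action of the vertex swap on morphisms. -/
def RudHom.sigma {X Y : RudRep k} (g : RudHom X Y) : RudHom X.sigma Y.sigma :=
  ⟨(g.1.2, g.1.1), g.2.2.2.1, g.2.2.2.2, g.2.1, g.2.2.1⟩

lemma IsSES.sigma {B E A : RudRep k} {ι : RudHom B E} {π : RudHom E A} (h : IsSES ι π) :
    IsSES ι.sigma π.sigma :=
  ⟨h.inj₂, h.inj₁, h.surj₂, h.surj₁, h.ex₂, h.ex₁⟩

lemma splits_iff {E A : RudRep k} (π : RudHom E A) :
    Splits π ↔ ∃ s : RudHom A E, (∀ a, π.1.1 (s.1.1 a) = a) ∧ ∀ a, π.1.2 (s.1.2 a) = a := by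
  constructor
  · rintro ⟨s, hs⟩
    have h := congrArg Subtype.val hs
    exact ⟨s, fun a => DFunLike.congr_fun (congrArg Prod.fst h) a,
      fun a => DFunLike.congr_fun (congrArg Prod.snd h) a⟩
  · rintro ⟨s, h1, h2⟩
    exact ⟨s, Subtype.ext (Prod.ext (LinearMap.ext h1) (LinearMap.ext h2))⟩

lemma Splits.sigma {E A : RudRep k} {π : RudHom E A} (h : Splits π) : Splits π.sigma := by
  obtain ⟨s, h1, h2⟩ := (splits_iff π).1 h
  exact (splits_iff _).2 ⟨s.sigma, h2, h1⟩

lemma RudIso.sigma {X Y : RudRep k} (h : RudIso X Y) : RudIso X.sigma Y.sigma := by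
  obtain ⟨g, h1, h2⟩ := h
  exact ⟨g.sigma, h2, h1⟩

lemma Ext1IsZero.sigma {A B : RudRep k} (h : Ext1IsZero A B) :
    Ext1IsZero A.sigma B.sigma := fun E _ _ hs =>
  Splits.sigma (h E.sigma _ _ hs.sigma)

/-- The vertex swap on extensions. -/
def RudExtn.sigma {A B : RudRep k} (x : RudExtn A B) : RudExtn A.sigma B.sigma :=
  ⟨x.E.sigma, x.ι.sigma, x.π.sigma, x.ses.sigma⟩

lemma RudExtnEquiv.sigma {A B : RudRep k} {x y : RudExtn A B} (h : RudExtnEquiv x y) :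
    RudExtnEquiv x.sigma y.sigma := by
  obtain ⟨φ, h1, h2, h3, h4⟩ := h
  exact ⟨φ.sigma, h2, h1, congrArg RudHom.sigma h3, congrArg RudHom.sigma h4⟩

lemma ext1Card_sigma (A B : RudRep k) : ext1Card A.sigma B.sigma = ext1Card A B := by
  let τ : RudExtn A B ≃ RudExtn A.sigma B.sigma :=
    ⟨RudExtn.sigma, fun y => RudExtn.sigma (A := A.sigma) (B := B.sigma) y,
      fun _ => rfl, fun _ => rfl⟩
  exact (Nat.card_congr (Quot.congr τ fun x y =>
    ⟨RudExtnEquiv.sigma, fun h => RudExtnEquiv.sigma (x := τ x) (y := τ y) h⟩)).symm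

namespace RudRep

/-- The involution interchanging `e ↔ f` and `e' ↔ f'`. -/
def flip (X : RudRep k) : RudRep k where
  V₁ := X.V₁
  V₂ := X.V₂
  e := X.f
  f := X.e
  e' := X.f'
  f' := X.e'
  rel_ee' := X.rel_ff'
  rel_e'e := X.rel_f'f
  rel_ff' := X.rel_ee'
  rel_f'f := X.rel_e'e
  rel_ef' := by rw [X.rel_ef', neg_neg]
  rel_e'f := by rw [X.rel_e'f, neg_neg]

end RudRep

/-- The functorial action of `RudRep.flip` on morphisms. -/
def RudHom.flip {X Y : RudRep k} (g : RudHom X Y) : RudHom X.flip Y.flip :=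
  ⟨(g.1.1, g.1.2), g.2.2.1, g.2.1, g.2.2.2.2, g.2.2.2.1⟩

lemma Ext1IsZero.flip {A B : RudRep k} (h : Ext1IsZero A B) :
    Ext1IsZero A.flip B.flip := by
  intro E ι π hs
  obtain ⟨s, h1, h2⟩ := (splits_iff _).1 (h E.flip (RudHom.flip ι) (RudHom.flip π)
    ⟨hs.inj₁, hs.inj₂, hs.surj₁, hs.surj₂, hs.ex₁, hs.ex₂⟩)
  exact (splits_iff _).2 ⟨s.flip, h1, h2⟩

end Duality

section HomApply

variable {X Y : RudRep k} (g : RudHom X Y)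

lemma RudHom.map_e (x : X.V₁) : Y.e (g.1.1 x) = g.1.2 (X.e x) := DFunLike.congr_fun g.2.1 x
lemma RudHom.map_f (x : X.V₁) : Y.f (g.1.1 x) = g.1.2 (X.f x) := DFunLike.congr_fun g.2.2.1 x
lemma RudHom.map_e' (y : X.V₂) : Y.e' (g.1.2 y) = g.1.1 (X.e' y) :=
  DFunLike.congr_fun g.2.2.2.1 y
lemma RudHom.map_f' (y : X.V₂) : Y.f' (g.1.2 y) = g.1.1 (X.f' y) :=
  DFunLike.congr_fun g.2.2.2.2 y

lemma IsSES.proj_incl₁ {B E A : RudRep k} {ι : RudHom B E} {π : RudHom E A} (h : IsSES ι π)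
    (b : B.V₁) : π.1.1 (ι.1.1 b) = 0 := by
  have : ι.1.1 b ∈ LinearMap.ker π.1.1 := h.ex₁ ▸ LinearMap.mem_range_self _ b
  exact this

lemma IsSES.proj_incl₂ {B E A : RudRep k} {ι : RudHom B E} {π : RudHom E A} (h : IsSES ι π)
    (b : B.V₂) : π.1.2 (ι.1.2 b) = 0 := by
  have : ι.1.2 b ∈ LinearMap.ker π.1.2 := h.ex₂ ▸ LinearMap.mem_range_self _ b
  exact this

end HomApply

section Vanishing

variable {V W : Type} [AddCommGroup V] [AddCommGroup W] [Module k V] [Module k W]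
  [FiniteDimensional k V] [FiniteDimensional k W]

/-- A linear map into the kernel of a surjection lifts along the kernel inclusion. -/
lemma exists_lift_of_exact {V B E A : Type} [AddCommGroup V] [AddCommGroup B] [AddCommGroup E]
    [AddCommGroup A] [Module k V] [Module k B] [Module k E] [Module k A]
    (i : B →ₗ[k] E) (p : E →ₗ[k] A) (hi : Function.Injective i)
    (hex : LinearMap.range i = LinearMap.ker p) (u : V →ₗ[k] E) (hu : ∀ v, p (u v) = 0) :
    ∃ γ : V →ₗ[k] B, ∀ v, i (γ v) = u v := by
  obtain ⟨g, hg⟩ := LinearMap.exists_leftInverse_of_injective i (LinearMap.ker_eq_bot.2 hi)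
  refine ⟨g ∘ₗ u, fun v => ?_⟩
  obtain ⟨b, hb⟩ : u v ∈ LinearMap.range i := by rw [hex]; exact hu v
  have : g (i b) = b := DFunLike.congr_fun hg b
  rw [LinearMap.comp_apply, ← hb, this]

lemma ext1IsZero_ofKron_id (N : V →ₗ[k] V) (P Q : W →ₗ[k] W)
    (H : ∀ γ : V →ₗ[k] W, (∀ v, Q (γ v) = P (γ (N v))) → γ = 0) :
    Ext1IsZero (RudRep.ofKron LinearMap.id N) (RudRep.ofKron P Q).sigma := by
  intro E ι π hs
  let i₁ : W →ₗ[k] E.V₁ := ι.1.1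
  let i₂ : W →ₗ[k] E.V₂ := ι.1.2
  let p₁ : E.V₁ →ₗ[k] V := π.1.1
  let p₂ : E.V₂ →ₗ[k] V := π.1.2
  have hπe : ∀ x, p₂ (E.e x) = p₁ x := fun x => (π.map_e x).symm
  have hπf : ∀ x, p₂ (E.f x) = N (p₁ x) := fun x => (π.map_f x).symm
  have hιe : ∀ y, E.e' (i₂ y) = i₁ (P y) := fun y => ι.map_e' y
  have hιf : ∀ y, E.f' (i₂ y) = i₁ (Q y) := fun y => ι.map_f' y
  have hi₁ : Function.Injective i₁ := hs.inj₁
  obtain ⟨s, hs'⟩ := LinearMap.exists_rightInverse_of_surjective p₁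
    (LinearMap.range_eq_top.2 hs.surj₁)
  have hsec : ∀ v, p₁ (s v) = v := fun v => DFunLike.congr_fun hs' v
  obtain ⟨γ, hγ⟩ := exists_lift_of_exact i₂ p₂ hs.inj₂ hs.ex₂
    (E.f ∘ₗ s - E.e ∘ₗ s ∘ₗ N) (fun v => by simp [hπe, hπf, hsec])
  simp only [LinearMap.sub_apply, LinearMap.comp_apply] at hγ
  have hγ0 : γ = 0 := by
    refine H γ fun v => hi₁ ?_
    rw [← hιf, ← hιe, hγ, hγ, map_sub, map_sub, E.f'f_apply, E.e'e_apply, E.e'f_apply]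
    simp
  have hfs : ∀ v, E.f (s v) = E.e (s (N v)) := fun v => by
    have := hγ v
    rw [hγ0, LinearMap.zero_apply, map_zero] at this
    exact sub_eq_zero.1 this.symm
  have hf' : ∀ v, E.f' (E.e (s v)) = 0 := fun v => by
    rw [← neg_eq_zero, ← E.e'f_apply, hfs, E.e'e_apply]
  exact (splits_iff π).2 ⟨⟨(s, E.e ∘ₗ s), rfl, LinearMap.ext hfs,
    LinearMap.ext fun v => (E.e'e_apply (s v)).trans (map_zero s).symm,
    LinearMap.ext fun v => (hf' v).trans (map_zero s).symm⟩, hsec,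
    fun v => (hπe (s v)).trans (hsec v)⟩

lemma ext1IsZero_Rrep_sigma (φ π : k[X]) (hφ : InSigma φ) (hπ : InSigma π) (hne : φ ≠ π)
    (m n : ℕ) : Ext1IsZero (Rrep φ m) (Rrep π n).sigma := by
  unfold Rrep
  rw [Matrix.toLin'_one, Matrix.toLin'_one, Matrix.toLin'_one, Matrix.toLin'_one]
  by_cases h0 : φ = 0
  · have h1 : π ≠ 0 := fun h => hne (h0.trans h.symm)
    rw [if_pos h0, if_neg h1]
    exact Ext1IsZero.flip (ext1IsZero_ofKron_id _ _ _ fun γ hγ =>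
      eq_zero_of_eq_comp_comp _ _ γ hγ (Or.inr (isNilpotent_Mblock_zero m)))
  · rw [if_neg h0]
    obtain ⟨hφm, hφi⟩ := hφ.resolve_left h0
    by_cases h1 : π = 0
    · rw [if_pos h1]
      exact ext1IsZero_ofKron_id _ _ _ fun γ hγ =>
        eq_zero_of_eq_comp_comp _ _ γ hγ (Or.inl (isNilpotent_Mblock_zero n))
    · rw [if_neg h1]
      obtain ⟨hπm, hπi⟩ := hπ.resolve_left h1
      have hcop : IsCoprime φ π := (hφi.coprime_iff_not_dvd).2 fun hd =>
        hne (eq_of_monic_of_associated hφm hπm (hφi.associated_of_dvd hπi hd))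
      exact ext1IsZero_ofKron_id _ _ _ fun γ hγ =>
        intertwiner_eq_zero_of_isCoprime _ _ (hcop.pow (m := m) (n := n))
          (aeval_pow_Mblock _ _ _ (aeval_companionMat φ hφm))
          (aeval_pow_Mblock _ _ _ (aeval_companionMat π hπm)) γ (LinearMap.ext hγ)

end Vanishing

section PointExtensions

/-- The sheer data of an extension of `A = (V, V; p, q)` by `σ(A)`, for scalars `p` and `q`. -/
structure IsPointExtn (p q : k) {V : Type} [AddCommGroup V] [Module k V] (E : RudRep k)
    (i₁ : V →ₗ[k] E.V₁) (i₂ : V →ₗ[k] E.V₂) (p₁ : E.V₁ →ₗ[k] V) (p₂ : E.V₂ →ₗ[k] V) :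
    Prop where
  inj₁ : Function.Injective i₁
  inj₂ : Function.Injective i₂
  surj₁ : Function.Surjective p₁
  ex₁ : LinearMap.range i₁ = LinearMap.ker p₁
  ex₂ : LinearMap.range i₂ = LinearMap.ker p₂
  incl_e : ∀ x, E.e (i₁ x) = 0
  incl_f : ∀ x, E.f (i₁ x) = 0
  incl_e' : ∀ y, E.e' (i₂ y) = p • i₁ y
  incl_f' : ∀ y, E.f' (i₂ y) = q • i₁ y
  proj_e : ∀ x, p₂ (E.e x) = p • p₁ x
  proj_f : ∀ x, p₂ (E.f x) = q • p₁ x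

variable {p q r t : k} {V : Type} [AddCommGroup V] [Module k V]

section

variable {E : RudRep k} {i₁ : V →ₗ[k] E.V₁} {i₂ : V →ₗ[k] E.V₂} {p₁ : E.V₁ →ₗ[k] V}
  {p₂ : E.V₂ →ₗ[k] V}

lemma IsPointExtn.exists_incl₁ (h : IsPointExtn p q E i₁ i₂ p₁ p₂) {x : E.V₁}
    (hx : p₁ x = 0) : ∃ b, i₁ b = x := by
  have : x ∈ LinearMap.range i₁ := h.ex₁ ▸ hx
  exact this

lemma IsPointExtn.exists_incl₂ (h : IsPointExtn p q E i₁ i₂ p₁ p₂) {y : E.V₂}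
    (hy : p₂ y = 0) : ∃ b, i₂ b = y := by
  have : y ∈ LinearMap.range i₂ := h.ex₂ ▸ hy
  exact this

lemma IsPointExtn.exists_section (h : IsPointExtn p q E i₁ i₂ p₁ p₂) :
    ∃ s : V →ₗ[k] E.V₁, ∀ v, p₁ (s v) = v := by
  obtain ⟨s, hs⟩ := LinearMap.exists_rightInverse_of_surjective p₁
    (LinearMap.range_eq_top.2 h.surj₁)
  exact ⟨s, fun v => DFunLike.congr_fun hs v⟩

/-- The combination `p f - q e` of the structure maps factors through a scalar, which is the class
of the extension. -/
lemma IsPointExtn.exists_class (hV : Module.finrank k V = 1)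
    (h : IsPointExtn p q E i₁ i₂ p₁ p₂) :
    ∃ c : k, ∀ x, p • E.f x - q • E.e x = c • i₂ (p₁ x) := by
  obtain ⟨s, hs⟩ := h.exists_section
  obtain ⟨γ, hγ⟩ := exists_lift_of_exact i₂ p₂ h.inj₂ h.ex₂ ((p • E.f - q • E.e) ∘ₗ s)
    (fun v => by simp [h.proj_e, h.proj_f, hs, smul_smul, mul_comm])
  obtain ⟨c, hc, -⟩ := LinearMap.existsUnique_eq_smul_id_of_finrank_eq_one hV γ
  refine ⟨c, fun x => ?_⟩
  obtain ⟨b, hb⟩ := h.exists_incl₁ (x := x - s (p₁ x)) (by simp [hs])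
  have hx : x = i₁ b + s (p₁ x) := by rw [hb]; abel
  have := hγ (p₁ x)
  rw [hc] at this
  simp only [LinearMap.smul_apply, LinearMap.id_apply, map_smul, LinearMap.comp_apply,
    LinearMap.sub_apply] at this
  rw [this]
  conv_lhs => rw [hx]
  simp [h.incl_e, h.incl_f]

section Class

variable {c : k} (h : IsPointExtn p q E i₁ i₂ p₁ p₂) (hrt : p * r + q * t = 1)
  (hc : ∀ x, p • E.f x - q • E.e x = c • i₂ (p₁ x))
include hrt hc

lemma e_eq_lift_sub (x : E.V₁) :
    E.e x = p • (r • E.e x + t • E.f x) - (t * c) • i₂ (p₁ x) := by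
  rw [mul_smul, ← hc]
  linear_combination (norm := module) (-hrt) • (E.e x)

lemma f_eq_lift_add (x : E.V₁) :
    E.f x = q • (r • E.e x + t • E.f x) + (r * c) • i₂ (p₁ x) := by
  rw [mul_smul, ← hc]
  linear_combination (norm := module) (-hrt) • (E.f x)

include h

lemma IsPointExtn.e'f_eq (x : E.V₁) : E.e' (E.f x) = c • i₁ (p₁ x) := by
  have h1 := congrArg E.e' (hc x)
  have h2 := congrArg E.f' (hc x)
  simp only [map_sub, map_smul, E.e'e_apply, E.f'f_apply, h.incl_e', h.incl_f'] at h1 h2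
  have h3 := E.e'f_apply x
  linear_combination (norm := module) r • h1 + t • h2 - hrt • (E.e' (E.f x) - c • i₁ (p₁ x))
    + (t * q) • h3

lemma IsPointExtn.e'_lift (x : E.V₁) :
    E.e' (r • E.e x + t • E.f x) = (t * c) • i₁ (p₁ x) := by
  rw [map_add, map_smul, map_smul, E.e'e_apply, h.e'f_eq hrt hc]
  module

lemma IsPointExtn.f'_lift (x : E.V₁) :
    E.f' (r • E.e x + t • E.f x) = -((r * c) • i₁ (p₁ x)) := by
  rw [map_add, map_smul, map_smul, E.f'f_apply, ← neg_eq_iff_eq_neg.2 (E.e'f_apply x),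
    h.e'f_eq hrt hc]
  module

omit hc in
lemma IsPointExtn.proj_lift (x : E.V₁) : p₂ (r • E.e x + t • E.f x) = p₁ x := by
  rw [map_add, map_smul, map_smul, h.proj_e, h.proj_f]
  linear_combination (norm := module) hrt • (p₁ x)

end Class

end

lemma linearCombination_pair {X : Type} [AddCommGroup X] [Module k X] (a b : X)
    (w : Fin 2 → k) : Fintype.linearCombination k ![a, b] w = w 0 • a + w 1 • b := by
  simp [Fintype.linearCombination_apply, Fin.sum_univ_two]

/-- The covering morphism `M → E` determined by an element `x` of `E` at the first vertex. -/
def RudHom.ofRepM {E : RudRep k} (x : E.V₁) : RudHom (repM k) E :=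
  ⟨(Fintype.linearCombination k ![x, E.e' (E.f x)],
    Fintype.linearCombination k ![E.e x, E.f x]), by
    have hef : E.e (E.e' (E.f x)) = 0 := E.ee'_apply _
    have hff : E.f (E.e' (E.f x)) = 0 := by
      rw [← neg_eq_iff_eq_neg.2 (E.ef'_apply (E.f x)), E.f'f_apply, map_zero, neg_zero]
    have hfe : E.f' (E.e x) = -E.e' (E.f x) := (neg_eq_iff_eq_neg.2 (E.e'f_apply x)).symm
    refine ⟨?_, ?_, ?_, ?_⟩ <;> refine LinearMap.ext fun (w : Fin 2 → k) => ?_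
    · change E.e (Fintype.linearCombination k ![x, E.e' (E.f x)] w) =
        Fintype.linearCombination k ![E.e x, E.f x] (Matrix.toLin' !![(1 : k), 0; 0, 0] w)
      simp [linearCombination_pair, dotProduct, hef]
    · change E.f (Fintype.linearCombination k ![x, E.e' (E.f x)] w) =
        Fintype.linearCombination k ![E.e x, E.f x] (Matrix.toLin' !![(0 : k), 0; 1, 0] w)
      simp [linearCombination_pair, dotProduct, hff]
    · change E.e' (Fintype.linearCombination k ![E.e x, E.f x] w) =
        Fintype.linearCombination k ![x, E.e' (E.f x)] (Matrix.toLin' !![(0 : k), 0; 0, 1] w)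
      simp [linearCombination_pair, dotProduct, E.e'e_apply]
    · change E.f' (Fintype.linearCombination k ![E.e x, E.f x] w) =
        Fintype.linearCombination k ![x, E.e' (E.f x)] (Matrix.toLin' !![(0 : k), 0; -1, 0] w)
      simp [linearCombination_pair, dotProduct, E.f'f_apply, hfe]⟩

lemma RudHom.ofRepM_fst_apply {E : RudRep k} (x : E.V₁) (w : Fin 2 → k) :
    (RudHom.ofRepM x).1.1 w = w 0 • x + w 1 • E.e' (E.f x) :=
  linearCombination_pair _ _ w

lemma RudHom.ofRepM_snd_apply {E : RudRep k} (x : E.V₁) (w : Fin 2 → k) :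
    (RudHom.ofRepM x).1.2 w = w 0 • E.e x + w 1 • E.f x :=
  linearCombination_pair _ _ w

lemma RudIso.symm {X Y : RudRep k} (h : RudIso X Y) : RudIso Y X := by
  obtain ⟨g, h1, h2⟩ := h
  let a := LinearEquiv.ofBijective g.1.1 h1
  let b := LinearEquiv.ofBijective g.1.2 h2
  have ha : ∀ x, g.1.1 (a.symm x) = x := a.apply_symm_apply
  have hb : ∀ x, g.1.2 (b.symm x) = x := b.apply_symm_apply
  refine ⟨⟨(a.symm.toLinearMap, b.symm.toLinearMap), ?_, ?_, ?_, ?_⟩, a.symm.bijective,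
    b.symm.bijective⟩ <;> refine LinearMap.ext fun x => ?_
  · exact h2.1 ((g.map_e _).symm.trans ((congrArg Y.e (ha x)).trans (hb _).symm))
  · exact h2.1 ((g.map_f _).symm.trans ((congrArg Y.f (ha x)).trans (hb _).symm))
  · exact h1.1 ((g.map_e' _).symm.trans ((congrArg Y.e' (hb x)).trans (ha _).symm))
  · exact h1.1 ((g.map_f' _).symm.trans ((congrArg Y.f' (hb x)).trans (ha _).symm))

lemma IsPointExtn.rudIso_repM {E : RudRep k} {i₁ : V →ₗ[k] E.V₁} {i₂ : V →ₗ[k] E.V₂}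
    {p₁ : E.V₁ →ₗ[k] V} {p₂ : E.V₂ →ₗ[k] V} {c : k} (hV : Module.finrank k V = 1)
    (h : IsPointExtn p q E i₁ i₂ p₁ p₂) (hrt : p * r + q * t = 1)
    (hc : ∀ x, p • E.f x - q • E.e x = c • i₂ (p₁ x)) (hc0 : c ≠ 0) : RudIso E (repM k) := by
  obtain ⟨u, hu0, hu⟩ := finrank_eq_one_iff'.1 hV
  obtain ⟨x, hx⟩ := h.surj₁ u
  have hw : E.e' (E.f x) = c • i₁ u := by rw [h.e'f_eq hrt hc, hx]
  have hp₁i : ∀ b, p₁ (i₁ b) = 0 := fun b => by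
    have : i₁ b ∈ LinearMap.ker p₁ := h.ex₁ ▸ LinearMap.mem_range_self _ b
    exact this
  have hi₁ : i₁ u ≠ 0 := (map_ne_zero_iff i₁ h.inj₁).2 hu0
  have hi₂ : i₂ u ≠ 0 := (map_ne_zero_iff i₂ h.inj₂).2 hu0
  have hcx := hc x
  rw [hx] at hcx
  have he := e_eq_lift_sub hrt hc x
  have hf := f_eq_lift_add hrt hc x
  rw [hx] at he hf
  refine RudIso.symm ⟨RudHom.ofRepM x, ⟨?_, ?_⟩, ⟨?_, ?_⟩⟩
  · refine (injective_iff_map_eq_zero _).2 fun (w : Fin 2 → k) hw0 => ?_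
    have hw1 : w 0 • x + w 1 • E.e' (E.f x) = 0 :=
      (RudHom.ofRepM_fst_apply x w).symm.trans hw0
    have h0 : w 0 = 0 := by
      have := congrArg p₁ hw1
      rw [hw] at this
      simpa [hp₁i, hx, hu0] using this
    have h1 : w 1 = 0 := by
      rw [h0, hw] at hw1
      simpa [hc0, hi₁] using hw1
    funext i
    fin_cases i
    · exact h0
    · exact h1
  · intro y
    obtain ⟨α, hα⟩ := hu (p₁ y)
    obtain ⟨b, hb⟩ := h.exists_incl₁ (x := y - α • x) (by simp [hx, hα])
    obtain ⟨β, hβ⟩ := hu b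
    refine ⟨![α, β * c⁻¹], ?_⟩
    have : α • x + (β * c⁻¹) • E.e' (E.f x) = y := by
      rw [hw, smul_smul, mul_assoc, inv_mul_cancel₀ hc0, mul_one, ← map_smul, hβ, hb]
      abel
    exact (RudHom.ofRepM_fst_apply x _).trans this
  · refine (injective_iff_map_eq_zero _).2 fun (w : Fin 2 → k) hw0 => ?_
    have hw1 : w 0 • E.e x + w 1 • E.f x = 0 :=
      (RudHom.ofRepM_snd_apply x w).symm.trans hw0
    have h0 : w 0 * p + w 1 * q = 0 := by
      have := congrArg p₂ hw1
      simp only [map_add, map_smul, h.proj_e, h.proj_f, hx, map_zero, smul_smul,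
        ← add_smul] at this
      exact (smul_eq_zero.1 this).resolve_right hu0
    have h1 : w 1 * r - w 0 * t = 0 := by
      have h2 : ((w 1 * r - w 0 * t) * c) • i₂ u = 0 := by
        linear_combination (norm := module) hw1 - w 0 • he - w 1 • hf
          - h0 • (r • E.e x + t • E.f x)
      simpa [hc0, hi₂] using h2
    have h2 : w 0 = 0 := by linear_combination -w 0 * hrt + r * h0 - q * h1
    have h3 : w 1 = 0 := by linear_combination -w 1 * hrt + t * h0 + p * h1
    funext i
    fin_cases i
    · exact h2
    · exact h3
  · intro y
    obtain ⟨α, hα⟩ := hu (p₂ y)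
    obtain ⟨b, hb⟩ := h.exists_incl₂ (y := y - α • (r • E.e x + t • E.f x))
      (by rw [map_sub, map_smul, h.proj_lift hrt, hx, hα, sub_self])
    obtain ⟨β, hβ⟩ := hu b
    refine ⟨![α * r - β * c⁻¹ * q, α * t + β * c⁻¹ * p], ?_⟩
    have : (α * r - β * c⁻¹ * q) • E.e x + (α * t + β * c⁻¹ * p) • E.f x = y := by
      rw [← hβ, map_smul] at hb
      have h4 : c⁻¹ • (p • E.f x - q • E.e x) = i₂ u := by
        rw [hcx, smul_smul, inv_mul_cancel₀ hc0, one_smul]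
      linear_combination (norm := module) β • h4 + hb
    exact (RudHom.ofRepM_snd_apply x _).trans this

variable [FiniteDimensional k V]

/-- The representation `(V, V; p, q)` with scalar structure maps. -/
abbrev pointRep (p q : k) (V : Type) [AddCommGroup V] [Module k V] [FiniteDimensional k V] :
    RudRep k :=
  RudRep.ofKron (p • (LinearMap.id : V →ₗ[k] V)) (q • LinearMap.id)

lemma IsSES.isPointExtn {E : RudRep k} {ι : RudHom (pointRep p q V).sigma E}
    {π : RudHom E (pointRep p q V)} (h : IsSES ι π) :
    IsPointExtn (V := V) p q E ι.1.1 ι.1.2 π.1.1 π.1.2 where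
  inj₁ := h.inj₁
  inj₂ := h.inj₂
  surj₁ := h.surj₁
  ex₁ := h.ex₁
  ex₂ := h.ex₂
  incl_e x := (ι.map_e x).trans (map_zero ι.1.2)
  incl_f x := (ι.map_f x).trans (map_zero ι.1.2)
  incl_e' y := (ι.map_e' y).trans (map_smul ι.1.1 p _)
  incl_f' y := (ι.map_f' y).trans (map_smul ι.1.1 q _)
  proj_e x := (π.map_e x).symm
  proj_f x := (π.map_f x).symm

/-- The class of an extension of `(V, V; p, q)` by its swap, as a relation. -/
def HasClass (x : RudExtn (pointRep p q V) (pointRep p q V).sigma) (c : k) : Prop :=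
  ∀ v : x.E.V₁, p • x.E.f v - q • x.E.e v = c • x.ι.1.2 (x.π.1.1 v)

lemma HasClass.unique (hV : Module.finrank k V = 1)
    {x : RudExtn (pointRep p q V) (pointRep p q V).sigma} {c d : k}
    (hc : HasClass x c) (hd : HasClass x d) : c = d := by
  obtain ⟨u, hu0, -⟩ := finrank_eq_one_iff'.1 hV
  obtain ⟨v, hv⟩ := x.ses.surj₁ u
  have h1 := (hc v).symm.trans (hd v)
  rw [← sub_eq_zero, ← sub_smul, hv] at h1
  have h2 : x.ι.1.2 u ≠ 0 := fun h => hu0 (x.ses.inj₂ (h.trans (map_zero x.ι.1.2).symm))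
  exact sub_eq_zero.1 ((smul_eq_zero.1 h1).resolve_right h2)

lemma HasClass.of_equiv {x y : RudExtn (pointRep p q V) (pointRep p q V).sigma} {c : k}
    (hc : HasClass x c) (h : RudExtnEquiv x y) : HasClass y c := by
  obtain ⟨φ, hφ, -, hι, hπ⟩ := h
  intro v
  obtain ⟨w, rfl⟩ := hφ.2 v
  have h1 : φ.1.2 (x.ι.1.2 (x.π.1.1 w)) = y.ι.1.2 (x.π.1.1 w) :=
    DFunLike.congr_fun (congrArg Prod.snd (congrArg Subtype.val hι)) _
  have h2 : y.π.1.1 (φ.1.1 w) = x.π.1.1 w :=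
    DFunLike.congr_fun (congrArg Prod.fst (congrArg Subtype.val hπ)) w
  have h3 := congrArg φ.1.2 (hc w)
  rw [map_sub, map_smul, map_smul, ← φ.map_e, ← φ.map_f] at h3
  refine h3.trans ((map_smul φ.1.2 c _).trans (congrArg (c • ·) (h1.trans ?_)))
  exact congrArg y.ι.1.2 h2.symm

/-- The middle term of the extension of `(V, V; p, q)` by its swap of class `c`. -/
def pointExtnRep (p q r t c : k) (V : Type) [AddCommGroup V] [Module k V]
    [FiniteDimensional k V] : RudRep k where
  V₁ := V × V
  V₂ := V × V
  e := (-(t * c) • LinearMap.snd k V V).prod (p • LinearMap.snd k V V)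
  f := ((r * c) • LinearMap.snd k V V).prod (q • LinearMap.snd k V V)
  e' := (p • LinearMap.fst k V V + (t * c) • LinearMap.snd k V V).prod 0
  f' := (q • LinearMap.fst k V V - (r * c) • LinearMap.snd k V V).prod 0
  rel_ee' := by ext <;> simp
  rel_e'e := by refine LinearMap.ext fun v => Prod.ext ?_ rfl; simp; module
  rel_ff' := by ext <;> simp
  rel_f'f := by refine LinearMap.ext fun v => Prod.ext ?_ rfl; simp; module
  rel_ef' := by ext <;> simp
  rel_e'f := by refine LinearMap.ext fun v => Prod.ext ?_ (by simp); simp; module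

/-- The extension of `(V, V; p, q)` by its swap of class `c`. -/
def pointExtn (p q r t c : k) (V : Type) [AddCommGroup V] [Module k V]
    [FiniteDimensional k V] : RudExtn (pointRep p q V) (pointRep p q V).sigma where
  E := pointExtnRep p q r t c V
  ι := ⟨(LinearMap.inl k V V, LinearMap.inl k V V), by
    refine ⟨?_, ?_, ?_, ?_⟩ <;> refine LinearMap.ext fun (v : V) => ?_
    · change ((-(t * c)) • (0 : V), p • (0 : V)) = ((0 : V), (0 : V))
      simp
    · change ((r * c) • (0 : V), q • (0 : V)) = ((0 : V), (0 : V))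
      simp
    · change (p • v + (t * c) • (0 : V), (0 : V)) = (p • v, (0 : V))
      simp
    · change (q • v - (r * c) • (0 : V), (0 : V)) = (q • v, (0 : V))
      simp⟩
  π := ⟨(LinearMap.snd k V V, LinearMap.snd k V V), rfl, rfl, rfl, rfl⟩
  ses := ⟨LinearMap.inl_injective (R := k) (M := V) (M₂ := V),
    LinearMap.inl_injective (R := k) (M := V) (M₂ := V),
    LinearMap.snd_surjective (R := k) (M := V) (M₂ := V),
    LinearMap.snd_surjective (R := k) (M := V) (M₂ := V),
    LinearMap.range_inl k V V, LinearMap.range_inl k V V⟩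

lemma hasClass_pointExtn (hrt : p * r + q * t = 1) (c : k) :
    HasClass (pointExtn p q r t c V) c := by
  intro (v : V × V)
  refine Prod.ext (α := V) (β := V) ?_ ?_
  · change p • (r * c) • v.2 - q • (-(t * c)) • v.2 = c • v.2
    linear_combination (norm := module) hrt • (c • v.2)
  · change p • q • v.2 - q • p • v.2 = c • (0 : V)
    module

/-- The short five lemma, in the form used to compare middle terms of extensions. -/
lemma bijective_of_exact {V Y : Type} [AddCommGroup V] [Module k V] [AddCommGroup Y]
    [Module k Y] (i : V →ₗ[k] Y) (s : V →ₗ[k] Y) (π : Y →ₗ[k] V)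
    (hi : Function.Injective i) (hex : LinearMap.range i = LinearMap.ker π)
    (hs : ∀ v, π (s v) = v) : Function.Bijective (i.coprod s) := by
  have hπi : ∀ b, π (i b) = 0 := fun b => by
    have : i b ∈ LinearMap.ker π := hex ▸ LinearMap.mem_range_self _ b
    exact this
  constructor
  · refine (injective_iff_map_eq_zero _).2 fun w hw => ?_
    rw [LinearMap.coprod_apply] at hw
    have h2 : w.2 = 0 := by
      have := congrArg π hw
      simpa [hπi, hs] using this
    rw [h2, map_zero, add_zero] at hw
    exact Prod.ext (hi (hw.trans (map_zero i).symm)) h2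
  · intro y
    have : y - s (π y) ∈ LinearMap.range i := by
      rw [hex, LinearMap.mem_ker, map_sub, hs, sub_self]
    obtain ⟨b, hb⟩ := this
    exact ⟨(b, π y), by rw [LinearMap.coprod_apply, hb]; abel⟩

lemma HasClass.equiv_pointExtn {x : RudExtn (pointRep p q V) (pointRep p q V).sigma} {c : k}
    (hrt : p * r + q * t = 1) (hc : HasClass x c) :
    RudExtnEquiv (pointExtn p q r t c V) x := by
  let i₁ : V →ₗ[k] x.E.V₁ := x.ι.1.1
  let i₂ : V →ₗ[k] x.E.V₂ := x.ι.1.2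
  let p₁ : x.E.V₁ →ₗ[k] V := x.π.1.1
  let p₂ : x.E.V₂ →ₗ[k] V := x.π.1.2
  have h : IsPointExtn p q x.E i₁ i₂ p₁ p₂ := x.ses.isPointExtn
  have hc : ∀ v, p • x.E.f v - q • x.E.e v = c • i₂ (p₁ v) := hc
  obtain ⟨s, hs⟩ := h.exists_section
  let s₂ : V →ₗ[k] x.E.V₂ := (r • x.E.e + t • x.E.f) ∘ₗ s
  have hs₂ : ∀ v, s₂ v = r • x.E.e (s v) + t • x.E.f (s v) := fun v => rfl
  have hps₂ : ∀ v, p₂ (s₂ v) = v := fun v => (h.proj_lift hrt (s v)).trans (hs v)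
  have hes := fun v => e_eq_lift_sub hrt hc (s v)
  have hfs := fun v => f_eq_lift_add hrt hc (s v)
  have hes' := fun v => h.e'_lift hrt hc (s v)
  have hfs' := fun v => h.f'_lift hrt hc (s v)
  simp only [hs, ← hs₂] at hes hfs hes' hfs'
  have hp₁i : ∀ b, p₁ (i₁ b) = 0 := x.ses.proj_incl₁
  have hp₂i : ∀ b, p₂ (i₂ b) = 0 := x.ses.proj_incl₂
  refine ⟨⟨(i₁.coprod s, i₂.coprod s₂), ?_, ?_, ?_, ?_⟩,
    bijective_of_exact i₁ s p₁ h.inj₁ h.ex₁ hs,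
    bijective_of_exact i₂ s₂ p₂ h.inj₂ h.ex₂ hps₂,
    Subtype.ext (Prod.ext ?_ ?_), Subtype.ext (Prod.ext ?_ ?_)⟩
  · refine LinearMap.ext fun (v : V × V) => ?_
    change x.E.e (i₁ v.1 + s v.2) = i₂ (-(t * c) • v.2) + s₂ (p • v.2)
    rw [map_add, h.incl_e, hes, map_smul, map_smul]
    module
  · refine LinearMap.ext fun (v : V × V) => ?_
    change x.E.f (i₁ v.1 + s v.2) = i₂ ((r * c) • v.2) + s₂ (q • v.2)
    rw [map_add, h.incl_f, hfs, map_smul, map_smul]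
    module
  · refine LinearMap.ext fun (v : V × V) => ?_
    change x.E.e' (i₂ v.1 + s₂ v.2) = i₁ (p • v.1 + (t * c) • v.2) + s 0
    rw [map_add, h.incl_e', hes', map_add, map_smul, map_smul, map_zero, add_zero]
  · refine LinearMap.ext fun (v : V × V) => ?_
    change x.E.f' (i₂ v.1 + s₂ v.2) = i₁ (q • v.1 - (r * c) • v.2) + s 0
    rw [map_add, h.incl_f', hfs', map_sub, map_smul, map_smul, map_zero, add_zero,
      sub_eq_add_neg]
  · refine LinearMap.ext fun (v : V) => ?_
    change i₁ v + s 0 = i₁ v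
    rw [map_zero, add_zero]
  · refine LinearMap.ext fun (v : V) => ?_
    change i₂ v + s₂ 0 = i₂ v
    rw [map_zero, add_zero]
  · refine LinearMap.ext fun (v : V × V) => ?_
    change p₁ (i₁ v.1 + s v.2) = v.2
    rw [map_add, hp₁i, hs, zero_add]
  · refine LinearMap.ext fun (v : V × V) => ?_
    change p₂ (i₂ v.1 + s₂ v.2) = v.2
    rw [map_add, hp₂i, hps₂, zero_add]

lemma ext1Card_pointRep (hV : Module.finrank k V = 1) (hrt : p * r + q * t = 1) :
    ext1Card (pointRep p q V) (pointRep p q V).sigma = Nat.card k := by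
  have hex : ∀ x : RudExtn (pointRep p q V) (pointRep p q V).sigma, ∃ c, HasClass x c :=
    fun x => x.ses.isPointExtn.exists_class hV
  choose cls hcls using hex
  refine Nat.card_congr (Equiv.ofBijective (Quot.lift cls fun x y h =>
    ((hcls x).of_equiv h).unique hV (hcls y)) ⟨?_, fun c => ?_⟩)
  · rintro ⟨x⟩ ⟨y⟩ (hxy : cls x = cls y)
    have h1 := (hcls x).equiv_pointExtn hrt
    have h2 := (hcls y).equiv_pointExtn hrt
    rw [← hxy] at h2
    exact (Quot.sound h1).symm.trans (Quot.sound h2)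
  · exact ⟨Quot.mk _ (pointExtn p q r t c V),
      (hcls _).unique hV (hasClass_pointExtn hrt c)⟩

lemma HasClass.splits {x : RudExtn (pointRep p q V) (pointRep p q V).sigma}
    (hrt : p * r + q * t = 1) (hc : HasClass x 0) : Splits x.π := by
  let i₁ : V →ₗ[k] x.E.V₁ := x.ι.1.1
  let i₂ : V →ₗ[k] x.E.V₂ := x.ι.1.2
  let p₁ : x.E.V₁ →ₗ[k] V := x.π.1.1
  let p₂ : x.E.V₂ →ₗ[k] V := x.π.1.2
  have h : IsPointExtn p q x.E i₁ i₂ p₁ p₂ := x.ses.isPointExtn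
  have hc : ∀ v, p • x.E.f v - q • x.E.e v = (0 : k) • i₂ (p₁ v) := hc
  obtain ⟨s, hs⟩ := h.exists_section
  have hs' : ∀ v, r • x.E.e (s v) + t • x.E.f (s v) =
      ((r • x.E.e + t • x.E.f) ∘ₗ s) v := fun v => rfl
  have hes := fun v => e_eq_lift_sub hrt hc (s v)
  have hfs := fun v => f_eq_lift_add hrt hc (s v)
  have hes' := fun v => h.e'_lift hrt hc (s v)
  have hfs' := fun v => h.f'_lift hrt hc (s v)
  have hps := fun v => (h.proj_lift hrt (s v)).trans (hs v)
  simp only [mul_zero, zero_smul, sub_zero, add_zero, neg_zero, hs'] at hes hfs hes' hfs' hps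
  refine (splits_iff x.π).2 ⟨⟨(s, (r • x.E.e + t • x.E.f) ∘ₗ s),
    LinearMap.ext fun v => (hes v).trans (map_smul _ p v).symm,
    LinearMap.ext fun v => (hfs v).trans (map_smul _ q v).symm,
    LinearMap.ext fun v => (hes' v).trans (map_zero s).symm,
    LinearMap.ext fun v => (hfs' v).trans (map_zero s).symm⟩, hs, hps⟩

lemma rudIso_repM_of_not_splits (hV : Module.finrank k V = 1) (hrt : p * r + q * t = 1)
    (E : RudRep k) (ι : RudHom (pointRep p q V).sigma E) (π : RudHom E (pointRep p q V))
    (hs : IsSES ι π) (hn : ¬ Splits π) : RudIso E (repM k) := by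
  obtain ⟨c, hc⟩ := hs.isPointExtn.exists_class hV
  refine hs.isPointExtn.rudIso_repM hV hrt hc ?_
  rintro rfl
  exact hn (HasClass.splits (x := ⟨E, ι, π, hs⟩) hrt hc)

lemma exists_Rrep_one_eq_pointRep (φ : k[X]) (hφ : InSigma1 φ) :
    ∃ (p q r t : k) (d : ℕ), p * r + q * t = 1 ∧
      Module.finrank k (Fin 1 × Fin d → k) = 1 ∧
      Rrep φ 1 = pointRep p q (Fin 1 × Fin d → k) := by
  by_cases h0 : φ = 0
  · refine ⟨0, 1, 0, 1, 1, by simp, by simp, ?_⟩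
    rw [Rrep, if_pos h0, Matrix.toLin'_one, pointRep, zero_smul, one_smul]
    congr 1
    rw [show Mblock (0 : Matrix (Fin 1) (Fin 1) k) 1 = 0 by
      ext ⟨i, a⟩ ⟨j, b⟩; simp [Mblock, Subsingleton.elim i j], map_zero]
  · obtain ⟨-, hd⟩ := hφ.resolve_left h0
    refine ⟨1, -φ.coeff 0, 1, 0, φ.natDegree, by simp, by simp [hd], ?_⟩
    rw [Rrep, if_neg h0, Matrix.toLin'_one, pointRep, one_smul]
    congr 1
    rw [← Matrix.toLin'_one, ← map_smul]
    congr 1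
    have : Subsingleton (Fin φ.natDegree) := by rw [hd]; infer_instance
    ext ⟨i, a⟩ ⟨j, b⟩
    obtain rfl := Subsingleton.elim i j
    obtain rfl := Subsingleton.elim a b
    have ha : (a : ℕ) = 0 := by omega
    simp [Mblock, companionMat, ha, hd]

end PointExtensions

/-- (a) For `φ ∈ Σ₁`, `Ext¹(R_φ(1), R_φ(1)') ≅ F_q` and the middle term
of any non-split extension `0 → R_φ(1)' → E → R_φ(1) → 0` is `M`; dually
`Ext¹(R_φ(1)', R_φ(1)) ≅ F_q` with non-split middle term `M'`.
(b) If `φ, π ∈ Σ` with `φ ≠ π`, then `Ext¹(R_φ(m), R_π(n)') = 0` and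
`Ext¹(R_π(n)', R_φ(m)) = 0` for all `m, n ≥ 1`. -/
theorem ext_between_regulars (F : Type) [Field F] [Fintype F] :
    (∀ φ : Polynomial F, InSigma1 φ →
      (ext1Card (Rrep φ 1) ((Rrep φ 1).sigma) = Fintype.card F ∧
        (∀ (E : RudRep F) (ι : RudHom ((Rrep φ 1).sigma) E) (π : RudHom E (Rrep φ 1)),
          IsSES ι π → ¬ Splits π → RudIso E (repM F)) ∧
        ext1Card ((Rrep φ 1).sigma) (Rrep φ 1) = Fintype.card F ∧
        (∀ (E : RudRep F) (ι : RudHom (Rrep φ 1) E) (π : RudHom E ((Rrep φ 1).sigma)),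
          IsSES ι π → ¬ Splits π → RudIso E (repM' F)))) ∧
    (∀ φ π : Polynomial F, InSigma φ → InSigma π → φ ≠ π → ∀ m n : ℕ, 1 ≤ m → 1 ≤ n →
      Ext1IsZero (Rrep φ m) ((Rrep π n).sigma) ∧
      Ext1IsZero ((Rrep π n).sigma) (Rrep φ m)) := by
  refine ⟨fun φ hφ => ?_, fun φ π hφ hπ hne m n _ _ =>
    ⟨ext1IsZero_Rrep_sigma φ π hφ hπ hne m n,
      (ext1IsZero_Rrep_sigma π φ hπ hφ hne.symm n m).sigma⟩⟩
  obtain ⟨p, q, r, t, d, hrt, hV, hR⟩ := exists_Rrep_one_eq_pointRep φ hφ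
  rw [hR, ← Nat.card_eq_fintype_card]
  have hcard := ext1Card_pointRep hV hrt
  exact ⟨hcard, rudIso_repM_of_not_splits hV hrt, (ext1Card_sigma _ _).trans hcard,
    fun E _ _ hs hn => RudIso.sigma (rudIso_repM_of_not_splits hV hrt E.sigma _ _ hs.sigma
      fun h => hn h.sigma)⟩
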